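/- Let G be a vertex-transitive graph of degree d and spectral radius λ. Then the expected degree δ of the free minimal spanning forest of G satisfies 1/(4λ) − 1/4 ≤ δ ≤ d. -/

import Mathlib

open MeasureTheory Filter

/-- A multigraph given by oriented edges: each oriented edge `e` has a `tail`, a `head`
and an opposite edge `op e ≠ e`. -/
structure Multigraph where
  V : Type
  E : Type
  tail : E → V
  head : E → V
  op : E → E
  op_op : ∀ e, op (op e) = e
  op_ne : ∀ e, op e ≠ e
  tail_op : ∀ e, tail (op e) = head e
  head_op : ∀ e, head (op e) = tail e

namespace Multigraph

variable (G : Multigraph)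

/-- `n` consecutive oriented edges: the head of each edge is the tail of the next one. -/
def IsWalk (n : ℕ) (c : Fin n → G.E) : Prop :=
  ∀ i : Fin n, ∀ h : (i : ℕ) + 1 < n, G.head (c i) = G.tail (c ⟨(i : ℕ) + 1, h⟩)

/-- A path of length `n` from `x` to `y`. -/
def IsWalkFromTo (n : ℕ) (c : Fin n → G.E) (x y : G.V) : Prop :=
  G.IsWalk n c ∧
    (∀ h : 0 < n, G.tail (c ⟨0, h⟩) = x ∧ G.head (c ⟨n - 1, by omega⟩) = y) ∧
    (n = 0 → x = y)

/-- `c(n,x,y)`: the number of paths of length `n` from `x` to `y`. -/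
noncomputable def pathCount (n : ℕ) (x y : G.V) : ℕ :=
  Nat.card {c : Fin n → G.E // G.IsWalkFromTo n c x y}

/-- Vertex transitivity: any vertex can be mapped to any other by a graph automorphism. -/
def VertexTransitive : Prop :=
  ∀ x y : G.V, ∃ (φV : G.V ≃ G.V) (φE : G.E ≃ G.E),
    (∀ e, G.tail (φE e) = φV (G.tail e)) ∧ (∀ e, G.head (φE e) = φV (G.head e)) ∧
    (∀ e, G.op (φE e) = φE (G.op e)) ∧ φV x = y

/-- Connectivity: any two vertices are joined by a sequence of edges. -/
def Connected : Prop :=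
  ∀ x y : G.V, Relation.ReflTransGen (fun u v => ∃ e, G.tail e = u ∧ G.head e = v) x y

/-- Each vertex has degree `d`, i.e. exactly `d` oriented edges emanate from it. -/
def Degree (d : ℕ) : Prop := ∀ x : G.V, Nat.card {e : G.E // G.tail e = x} = d

/-- The spectral radius `(1/d)·limsup_n c(n)^{1/n}`, where `c(n)` is the number of cycles
of length `n` rooted at the base vertex `x₀`. -/
noncomputable def spectralRadius (d : ℕ) (x₀ : G.V) : ℝ :=
  (1 / (d : ℝ)) * limsup (fun n : ℕ => (G.pathCount n x₀ x₀ : ℝ) ^ ((n : ℝ)⁻¹)) atTop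

/-- Unordered edges: oriented edges modulo the orientation reversal `op`. -/
def UEdge : Type := Quot (fun e f : G.E => f = G.op e)

/-- The unordered edge underlying an oriented edge. -/
def uedge (e : G.E) : G.UEdge := Quot.mk _ e

/-- A simple cycle of length `n ≥ 1` rooted at `x`: a closed path from `x` to `x` in which
no vertex is visited twice and which is not a backtracking pair `(e, op e)`. -/
def IsSimpleCycle (n : ℕ) (c : Fin n → G.E) (x : G.V) : Prop :=
  1 ≤ n ∧ G.IsWalkFromTo n c x x ∧
    Function.Injective (fun i : Fin n => G.tail (c i)) ∧
    ∀ h : n = 2, c ⟨1, by omega⟩ ≠ G.op (c ⟨0, by omega⟩)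

/-- In the labelling `lbl`, the edge `e` is cut: it belongs to some simple cycle on which
its label is maximal. -/
def IsCut (lbl : G.UEdge → ℝ) (e : G.E) : Prop :=
  ∃ (n : ℕ) (x : G.V) (c : Fin n → G.E), G.IsSimpleCycle n c x ∧
    ∃ i : Fin n, (c i = e ∨ c i = G.op e) ∧
      ∀ j : Fin n, lbl (G.uedge (c j)) ≤ lbl (G.uedge (c i))

/-- The edge `e` survives the cutting procedure defining the free minimal spanning
forest. -/
def Survives (lbl : G.UEdge → ℝ) (e : G.E) : Prop := ¬ G.IsCut lbl e

/-- `μ` is the distribution of i.i.d. uniform-`[0,1]` labels on the unordered edges. -/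
def IsIIDUniform (μ : Measure (G.UEdge → ℝ)) : Prop :=
  IsProbabilityMeasure μ ∧
    ∀ (s : Finset G.UEdge) (f : G.UEdge → Set ℝ), (∀ e ∈ s, MeasurableSet (f e)) →
      μ {lbl | ∀ e ∈ s, lbl e ∈ f e} = ∏ e ∈ s, volume (f e ∩ Set.Icc (0 : ℝ) 1)

/-- Number of surviving oriented edges at `x₀` in the labelling `lbl`. -/
noncomputable def survivingDegree (lbl : G.UEdge → ℝ) (x₀ : G.V) : ℕ :=
  Nat.card {e : {e : G.E // G.tail e = x₀} // G.Survives lbl e.1}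

end Multigraph

open Multigraph MeasureTheory

namespace Multigraph

variable {G : Multigraph}

lemma uedge_op (e : G.E) : G.uedge (G.op e) = G.uedge e :=
  (Quot.sound (r := fun e f : G.E => f = G.op e) rfl).symm

lemma uedge_eq_iff {e f : G.E} : G.uedge e = G.uedge f ↔ f = e ∨ f = G.op e := by
  refine ⟨fun h => ?_, ?_⟩
  · let s : G.UEdge → Set G.E := Quot.lift (fun e => {e, G.op e}) (by
      rintro a b rfl
      rw [G.op_op, Set.pair_comm])
    have hs : s (G.uedge e) = s (G.uedge f) := congrArg s h
    have hf : f ∈ s (G.uedge f) := Set.mem_insert f _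
    rw [← hs] at hf
    exact hf
  · rintro (rfl | rfl)
    · rfl
    · exact (uedge_op e).symm

/-! ### Closed walks and simple cycles, indexed cyclically -/

lemma isWalkFromTo_succ_iff {m : ℕ} {c : Fin (m + 1) → G.E} {x : G.V} :
    G.IsWalkFromTo (m + 1) c x x ↔
      (∀ j, G.head (c j) = G.tail (c (j + 1))) ∧ G.tail (c 0) = x := by
  constructor
  · rintro ⟨hw, hx, -⟩
    obtain ⟨h0, hl⟩ := hx m.succ_pos
    refine ⟨fun j => ?_, h0⟩
    by_cases hj : (j : ℕ) + 1 < m + 1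
    · rw [hw j hj]
      congr 2
      ext
      rw [Fin.val_add_one_of_lt' hj]
    · have hj' : j = Fin.last m := by ext; simp; omega
      subst hj'
      rw [Fin.last_add_one]
      exact hl.trans h0.symm
  · rintro ⟨hc, h0⟩
    refine ⟨fun j hj => ?_, fun _ => ⟨h0, ?_⟩, by simp⟩
    · rw [hc j]
      congr 2
      ext
      rw [Fin.val_add_one_of_lt' hj]
    · have := hc (Fin.last m)
      rw [Fin.last_add_one, h0] at this
      exact this

lemma isSimpleCycle_succ_iff {m : ℕ} {c : Fin (m + 1) → G.E} {x : G.V} :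
    G.IsSimpleCycle (m + 1) c x ↔
      (∀ j, G.head (c j) = G.tail (c (j + 1))) ∧ G.tail (c 0) = x ∧
        Function.Injective (fun j => G.tail (c j)) ∧
        Function.Injective (fun j => G.uedge (c j)) := by
  unfold IsSimpleCycle
  rw [isWalkFromTo_succ_iff]
  constructor
  · rintro ⟨-, ⟨hc, h0⟩, hinj, h2⟩
    refine ⟨hc, h0, hinj, fun j k hjk => ?_⟩
    rcases uedge_eq_iff.1 hjk with h | h
    · exact hinj (congrArg G.tail h.symm)
    · by_contra hne
      have hk : k = j + 1 := hinj (by simp only [h, G.tail_op]; exact hc j)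
      have hj : j = k + 1 := hinj (by
        simp only
        rw [← hc k, h, G.head_op])
      have h11 : (1 + 1 : Fin (m + 1)) = 0 := by
        rw [hk, add_assoc] at hj
        simpa using hj.symm
      have hm : m = 1 := by
        rcases m with _ | _ | m
        · exact absurd (Fin.ext (by omega)) hne
        · rfl
        · have := congrArg Fin.val h11
          rw [Fin.val_add, Fin.val_one, Fin.val_zero, Nat.mod_eq_of_lt (by omega)] at this
          omega
      subst hm
      have h2' : c 1 ≠ G.op (c 0) := h2 rfl
      fin_cases j <;> fin_cases k
      · exact hne rfl
      · exact h2' h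
      · exact h2' (by
          change c 0 = G.op (c 1) at h
          rw [h, G.op_op])
      · exact hne rfl
  · rintro ⟨hc, h0, hinj, hu⟩
    refine ⟨by omega, ⟨hc, h0⟩, hinj, fun h hop => ?_⟩
    have := hu (show G.uedge (c ⟨1, by omega⟩) = G.uedge (c ⟨0, by omega⟩) by
      rw [hop, uedge_op])
    simp at this

/-- A cut edge is the first edge of some simple cycle on which its label is maximal. -/
lemma isCut_iff {lbl : G.UEdge → ℝ} {e : G.E} :
    G.IsCut lbl e ↔ ∃ (m : ℕ) (c : Fin (m + 1) → G.E),
      G.IsSimpleCycle (m + 1) c (G.tail e) ∧ c 0 = e ∧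
        ∀ j, lbl (G.uedge (c j)) ≤ lbl (G.uedge e) := by
  constructor
  · rintro ⟨n, x, c, hc, i, hi, hmax⟩
    obtain ⟨m, rfl⟩ : ∃ m, n = m + 1 := ⟨n - 1, by have := hc.1; omega⟩
    obtain ⟨hcyc, -, hinj, hu⟩ := isSimpleCycle_succ_iff.1 hc
    rcases hi with rfl | hi
    · refine ⟨m, fun j => c (i + j), isSimpleCycle_succ_iff.2 ⟨fun j => ?_, by simp, ?_, ?_⟩,
        by simp, fun j => hmax _⟩
      · rw [hcyc, add_assoc]
      · exact hinj.comp (add_right_injective i)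
      · exact hu.comp (add_right_injective i)
    · have he : e = G.op (c i) := by rw [hi, G.op_op]
      subst he
      have htail : ∀ j, G.tail (G.op (c (i - j))) = G.tail (c (i - j + 1)) := fun j => by
        rw [G.tail_op, hcyc]
      refine ⟨m, fun j => G.op (c (i - j)),
        isSimpleCycle_succ_iff.2 ⟨fun j => ?_, by simp, ?_, ?_⟩, by simp, fun j => ?_⟩
      · rw [G.head_op, htail]
        congr 2
        abel
      · simp only [htail]
        exact hinj.comp ((add_left_injective 1).comp sub_right_injective)
      · simp only [uedge_op]
        exact hu.comp sub_right_injective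
      · rw [uedge_op, uedge_op]
        exact hmax _
  · rintro ⟨m, c, hc, rfl, hmax⟩
    exact ⟨m + 1, _, c, hc, 0, Or.inl rfl, hmax⟩

/-! ### Counting closed walks -/

/-- Closed walks of length `n` rooted at `x`. -/
abbrev ClosedWalk (G : Multigraph) (x : G.V) (n : ℕ) : Type :=
  {c : Fin n → G.E // G.IsWalkFromTo n c x x}

lemma Degree.finite {d : ℕ} (hdeg : G.Degree d) (hd : 1 ≤ d) (x : G.V) :
    Finite {e : G.E // G.tail e = x} :=
  Nat.finite_of_card_ne_zero (by rw [hdeg x]; omega)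

lemma Degree.exists_code {d : ℕ} (hdeg : G.Degree d) (hd : 1 ≤ d) :
    ∃ code : G.E → Fin d, ∀ e f, G.tail e = G.tail f → code e = code f → e = f := by
  have h : ∀ x, Nonempty ({e : G.E // G.tail e = x} ≃ Fin d) := fun x => by
    have := hdeg.finite hd x
    exact ⟨Finite.equivFinOfCardEq (hdeg x)⟩
  refine ⟨fun e => (h (G.tail e)).some ⟨e, rfl⟩, fun e f hef hcode => ?_⟩
  have key : ∀ (x y : G.V) (hx : G.tail e = x) (hy : G.tail f = y), x = y →
      (h x).some ⟨e, hx⟩ = (h y).some ⟨f, hy⟩ → e = f := by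
    rintro x _ hx hy rfl hxy
    simpa using (h x).some.injective hxy
  exact key _ _ rfl rfl hef hcode

lemma Degree.exists_walk_code {d : ℕ} (hdeg : G.Degree d) (hd : 1 ≤ d) (x : G.V) (n : ℕ) :
    ∃ F : G.ClosedWalk x n → (Fin n → Fin d), Function.Injective F := by
  obtain ⟨code, hcode⟩ := hdeg.exists_code hd
  refine ⟨fun c i => code (c.1 i), ?_⟩
  rintro ⟨a, ha⟩ ⟨b, hb⟩ hab
  have hab' : ∀ i, code (a i) = code (b i) := fun i => congrFun hab i
  have key : ∀ k (hk : k < n), a ⟨k, hk⟩ = b ⟨k, hk⟩ := by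
    intro k
    induction k with
    | zero => exact fun hk => hcode _ _ ((ha.2.1 hk).1.trans (hb.2.1 hk).1.symm) (hab' _)
    | succ k ih =>
      intro hk
      refine hcode _ _ ?_ (hab' _)
      have h1 := ha.1 ⟨k, by omega⟩ hk
      have h2 := hb.1 ⟨k, by omega⟩ hk
      rw [ih] at h1
      exact h1.symm.trans h2
  exact Subtype.ext (funext fun i => key i i.2)

lemma Degree.finite_closedWalk {d : ℕ} (hdeg : G.Degree d) (hd : 1 ≤ d) (x : G.V) (n : ℕ) :
    Finite (G.ClosedWalk x n) :=
  let ⟨_, hF⟩ := hdeg.exists_walk_code hd x n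
  Finite.of_injective _ hF

lemma Degree.pathCount_le_pow {d : ℕ} (hdeg : G.Degree d) (hd : 1 ≤ d) (x : G.V) (n : ℕ) :
    G.pathCount n x x ≤ d ^ n := by
  obtain ⟨F, hF⟩ := hdeg.exists_walk_code hd x n
  exact (Nat.card_le_card_of_injective F hF).trans (by simp)

lemma IsWalkFromTo.append {m n : ℕ} {a : Fin m → G.E} {b : Fin n → G.E} {x y z : G.V}
    (ha : G.IsWalkFromTo m a x y) (hb : G.IsWalkFromTo n b y z) :
    G.IsWalkFromTo (m + n) (Fin.append a b) x z := by
  have hl : ∀ k (hk : k < m + n) (h : k < m), Fin.append a b ⟨k, hk⟩ = a ⟨k, h⟩ :=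
    fun k hk h => Fin.append_left a b ⟨k, h⟩
  have hr : ∀ k (hk : k < m + n) (h : m ≤ k),
      Fin.append a b ⟨k, hk⟩ = b ⟨k - m, by omega⟩ := fun k hk h => by
    rw [← Fin.append_right a b ⟨k - m, by omega⟩]
    congr 1
    ext
    simp
    omega
  refine ⟨?_, fun h => ⟨?_, ?_⟩, fun h => ?_⟩
  · rintro ⟨k, hk⟩ hk'
    simp only at hk' ⊢
    rcases lt_trichotomy (k + 1) m with h | h | h
    · rw [hl _ _ (by omega), hl _ _ h]
      exact ha.1 ⟨k, by omega⟩ h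
    · rw [hl _ _ (by omega), hr _ _ h.ge]
      have h1 := (ha.2.1 (by omega)).2
      have h2 := (hb.2.1 (by omega)).1
      subst h
      simp only [Nat.add_sub_cancel, Nat.sub_self] at h1 h2 ⊢
      exact h1.trans h2.symm
    · rw [hr _ _ (by omega), hr _ _ h.le, hb.1 ⟨k - m, by omega⟩ (by simp only; omega)]
      congr 3
      simp only
      omega
  · rcases Nat.eq_zero_or_pos m with h0 | h0
    · rw [hr _ _ h0.le, ha.2.2 h0]
      simpa [h0] using (hb.2.1 (by omega)).1
    · rw [hl _ _ h0]
      exact (ha.2.1 h0).1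
  · rcases Nat.eq_zero_or_pos n with h0 | h0
    · rw [hl _ _ (by omega), ← hb.2.2 h0, ← (ha.2.1 (by omega)).2]
      congr 3
      omega
    · rw [hr _ _ (by omega), ← (hb.2.1 h0).2]
      congr 3
      omega
  · exact (ha.2.2 (by omega)).trans (hb.2.2 (by omega))

lemma Degree.pathCount_mul_le {d : ℕ} (hdeg : G.Degree d) (hd : 1 ≤ d) (x : G.V) (m n : ℕ) :
    G.pathCount m x x * G.pathCount n x x ≤ G.pathCount (m + n) x x := by
  have := hdeg.finite_closedWalk hd x (m + n)
  unfold pathCount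
  rw [← Nat.card_prod]
  refine Nat.card_le_card_of_injective
    (fun p : G.ClosedWalk x m × G.ClosedWalk x n =>
      (⟨Fin.append p.1.1 p.2.1, p.1.2.append p.2.2⟩ : G.ClosedWalk x (m + n))) ?_
  rintro ⟨⟨a, ha⟩, ⟨b, hb⟩⟩ ⟨⟨a', ha'⟩, ⟨b', hb'⟩⟩ h
  have h' : Fin.append a b = Fin.append a' b' := Subtype.ext_iff.1 h
  have h1 : a = a' := funext fun i => by
    simpa using congrFun h' (Fin.castAdd n i)
  have h2 : b = b' := funext fun i => by
    simpa using congrFun h' (Fin.natAdd m i)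
  subst h1 h2
  rfl

lemma Degree.pathCount_pow_le {d : ℕ} (hdeg : G.Degree d) (hd : 1 ≤ d) (x : G.V) (n k : ℕ) :
    G.pathCount n x x ^ (k + 1) ≤ G.pathCount ((k + 1) * n) x x := by
  induction k with
  | zero => simp
  | succ k ih =>
    rw [pow_succ, add_mul (k + 1), one_mul]
    exact (Nat.mul_le_mul_right _ ih).trans (hdeg.pathCount_mul_le hd x _ n)

lemma Degree.pathCount_le_spectralRadius_pow {d : ℕ} (hdeg : G.Degree d) (hd : 1 ≤ d)
    (x : G.V) {n : ℕ} (hn : n ≠ 0) :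
    (G.pathCount n x x : ℝ) ≤ (d * G.spectralRadius d x) ^ n := by
  have hd0 : (d : ℝ) ≠ 0 := by positivity
  set u : ℕ → ℝ := fun n : ℕ => (G.pathCount n x x : ℝ) ^ ((n : ℝ)⁻¹)
  have hL : d * G.spectralRadius d x = limsup u atTop := by
    rw [spectralRadius, ← mul_assoc, mul_one_div_cancel hd0, one_mul]
  have hbdd : IsBoundedUnder (· ≤ ·) atTop u := by
    refine isBoundedUnder_of_eventually_le (a := (d : ℝ)) ?_
    filter_upwards [eventually_ne_atTop 0] with m hm
    have h : (G.pathCount m x x : ℝ) ≤ (d : ℝ) ^ m := by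
      exact_mod_cast hdeg.pathCount_le_pow hd x m
    calc u m ≤ ((d : ℝ) ^ m) ^ ((m : ℝ)⁻¹) :=
          Real.rpow_le_rpow (by positivity) h (by positivity)
      _ = d := Real.pow_rpow_inv_natCast (by positivity) hm
  have hle : u n ≤ limsup u atTop := by
    refine le_limsup_of_frequently_le (frequently_atTop.2 fun N => ⟨(N + 1) * n, ?_, ?_⟩) hbdd
    · exact N.le_succ.trans (Nat.le_mul_of_pos_right _ (Nat.pos_of_ne_zero hn))
    · have h : (G.pathCount n x x : ℝ) ^ (N + 1) ≤ G.pathCount ((N + 1) * n) x x := by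
        exact_mod_cast hdeg.pathCount_pow_le hd x n N
      calc u n = ((G.pathCount n x x : ℝ) ^ (N + 1)) ^ ((((N + 1) * n : ℕ) : ℝ)⁻¹) := by
            rw [Nat.cast_mul, mul_inv, Real.rpow_mul (by positivity),
              Real.pow_rpow_inv_natCast (by positivity) N.succ_ne_zero]
        _ ≤ u ((N + 1) * n) := Real.rpow_le_rpow (by positivity) h (by positivity)
  rw [hL]
  calc (G.pathCount n x x : ℝ) = u n ^ n := (Real.rpow_inv_natCast_pow (by positivity) hn).symm
    _ ≤ _ := pow_le_pow_left₀ (by positivity) hle n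

lemma isWalkFromTo_one {e : G.E} : G.IsWalkFromTo 1 (fun _ => e) (G.tail e) (G.head e) :=
  ⟨fun i h => absurd h (by omega), fun _ => ⟨rfl, rfl⟩, by simp⟩

lemma Degree.one_le_mul_spectralRadius {d : ℕ} (hdeg : G.Degree d) (hd : 1 ≤ d) (x : G.V)
    (hpos : 0 ≤ G.spectralRadius d x) : 1 ≤ d * G.spectralRadius d x := by
  obtain ⟨⟨e, rfl⟩⟩ : Nonempty {e : G.E // G.tail e = x} :=
    (Nat.card_pos_iff.1 (by rw [hdeg x]; omega)).1
  have := hdeg.finite_closedWalk hd (G.tail e) 2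
  have hwalk : G.IsWalkFromTo 2 _ (G.tail e) (G.tail e) :=
    isWalkFromTo_one.append (m := 1) (n := 1) (b := fun _ => G.op e) (by
      have := isWalkFromTo_one (e := G.op e)
      rwa [G.tail_op, G.head_op] at this)
  have h2 : 1 ≤ G.pathCount 2 (G.tail e) (G.tail e) :=
    Nat.card_pos_iff.2 ⟨⟨⟨_, hwalk⟩⟩, this⟩
  have h := hdeg.pathCount_le_spectralRadius_pow hd (G.tail e) two_ne_zero
  have h2' : (1 : ℝ) ≤ (d * G.spectralRadius d (G.tail e)) ^ 2 :=
    le_trans (by exact_mod_cast h2) h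
  exact (one_le_sq_iff₀ (by positivity)).1 h2'

lemma Degree.one_le_spectralRadius_of_loops {d : ℕ} (hdeg : G.Degree d) (hd : 1 ≤ d) (x : G.V)
    (hloop : ∀ e, G.tail e = x → G.head e = x) : 1 ≤ G.spectralRadius d x := by
  have := hdeg.finite_closedWalk hd x 1
  have hcard : d ≤ G.pathCount 1 x x := by
    rw [← hdeg x]
    refine Nat.card_le_card_of_injective
      (fun e => (⟨fun _ => e.1, by
        have h := isWalkFromTo_one (e := e.1)
        rwa [hloop e.1 e.2, e.2] at h⟩ : G.ClosedWalk x 1)) ?_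
    rintro ⟨e, he⟩ ⟨f, hf⟩ h
    exact Subtype.ext (congrFun (Subtype.ext_iff.1 h) 0)
  have h := hdeg.pathCount_le_spectralRadius_pow hd x one_ne_zero
  rw [pow_one] at h
  have hd' : (d : ℝ) ≤ G.pathCount 1 x x := by exact_mod_cast hcard
  have hd0 : (0 : ℝ) < d := by positivity
  nlinarith

/-! ### Probabilities of labelling events -/

lemma IsIIDUniform.measure_forall_le {μ : Measure (G.UEdge → ℝ)} (hμ : G.IsIIDUniform μ)
    {ι : Type*} [Fintype ι] {a : ι → G.UEdge} (ha : Function.Injective a) {p : ℝ}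
    (hp : p ≤ 1) :
    μ {lbl | ∀ i, lbl (a i) ≤ p} = ENNReal.ofReal p ^ Fintype.card ι := by
  classical
  have h := hμ.2 (Finset.univ.image a) (fun _ => Set.Iic p) (fun _ _ => measurableSet_Iic)
  have hIcc : Set.Iic p ∩ Set.Icc (0 : ℝ) 1 = Set.Icc 0 p := by
    ext t
    simp only [Set.mem_inter_iff, Set.mem_Iic, Set.mem_Icc]
    exact ⟨fun ⟨h1, h2, _⟩ => ⟨h2, h1⟩, fun ⟨h1, h2⟩ => ⟨h2, h1, h2.trans hp⟩⟩
  rw [hIcc, Finset.prod_const, Finset.card_image_of_injective _ ha, Real.volume_Icc,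
    sub_zero] at h
  simpa using h

lemma IsIIDUniform.ae_ne {μ : Measure (G.UEdge → ℝ)} (hμ : G.IsIIDUniform μ) {a b : G.UEdge}
    (hab : a ≠ b) : ∀ᵐ lbl ∂μ, lbl a ≠ lbl b := by
  classical
  set ν : Measure ℝ := volume.restrict (Set.Icc 0 1)
  have hmeas : Measurable fun lbl : G.UEdge → ℝ => (lbl a, lbl b) :=
    (measurable_pi_apply a).prodMk (measurable_pi_apply b)
  have hprod : ν.prod ν = μ.map fun lbl => (lbl a, lbl b) := by
    refine Measure.prod_eq fun s t hs ht => ?_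
    rw [Measure.map_apply hmeas (hs.prod ht), Measure.restrict_apply hs,
      Measure.restrict_apply ht]
    have h := hμ.2 {a, b} (fun e => if e = a then s else t) (fun e _ => by
      split_ifs <;> assumption)
    rw [Finset.prod_pair hab] at h
    simp only [if_true, if_neg hab.symm] at h
    rw [← h]
    congr 1
    ext lbl
    simp [hab.symm]
  have hdiag : MeasurableSet {q : ℝ × ℝ | q.1 = q.2} :=
    measurableSet_eq_fun measurable_fst measurable_snd
  have hzero : ν.prod ν {q : ℝ × ℝ | q.1 = q.2} = 0 := by
    rw [Measure.measure_prod_null hdiag]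
    refine Eventually.of_forall fun t => ?_
    have : Prod.mk t ⁻¹' {q : ℝ × ℝ | q.1 = q.2} = {t} := by
      ext s
      simp [eq_comm]
    simp [this]
  rw [hprod, Measure.map_apply hmeas hdiag] at hzero
  rw [ae_iff]
  simpa using hzero

lemma measurableSet_forall_le {m : ℕ} (c : Fin m → G.E) (f : (G.UEdge → ℝ) → ℝ)
    (hf : Measurable f) : MeasurableSet {lbl : G.UEdge → ℝ | ∀ j, lbl (G.uedge (c j)) ≤ f lbl} := by
  rw [Set.ofPred_forall]
  exact MeasurableSet.iInter fun _ => measurableSet_le (measurable_pi_apply _) hf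

lemma Degree.measurableSet_isCut {d : ℕ} (hdeg : G.Degree d) (hd : 1 ≤ d) (e : G.E) :
    MeasurableSet {lbl | G.IsCut lbl e} := by
  have : {lbl | G.IsCut lbl e} = ⋃ (m : ℕ) (c : G.ClosedWalk (G.tail e) (m + 1)),
      {lbl | G.IsSimpleCycle (m + 1) c.1 (G.tail e) ∧ c.1 0 = e} ∩
        {lbl | ∀ j, lbl (G.uedge (c.1 j)) ≤ lbl (G.uedge e)} := by
    ext lbl
    simp only [Set.mem_ofPred_eq, isCut_iff, Set.mem_iUnion, Set.mem_inter_iff]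
    constructor
    · rintro ⟨m, c, hc, h0, hmax⟩
      exact ⟨m, ⟨c, hc.2.1⟩, ⟨hc, h0⟩, hmax⟩
    · rintro ⟨m, c, ⟨hc, h0⟩, hmax⟩
      exact ⟨m, c.1, hc, h0, hmax⟩
  rw [this]
  refine MeasurableSet.iUnion fun m => ?_
  have := hdeg.finite_closedWalk hd (G.tail e) (m + 1)
  exact MeasurableSet.iUnion fun c => (MeasurableSet.const _).inter
    (measurableSet_forall_le c.1 _ (measurable_pi_apply _))

/-- Union bound over simple cycles for the event that an edge with a small label is cut. -/
lemma Degree.sum_measure_isCut_le {d : ℕ} (hdeg : G.Degree d) (hd : 1 ≤ d) (x : G.V)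
    [Fintype {e : G.E // G.tail e = x}] {μ : Measure (G.UEdge → ℝ)} (hμ : G.IsIIDUniform μ)
    {p : ℝ} (hp : p ≤ 1) :
    ∑ e : {e : G.E // G.tail e = x}, μ {lbl | lbl (G.uedge e.1) ≤ p ∧ G.IsCut lbl e.1} ≤
      ∑' m : ℕ, (G.pathCount (m + 1) x x : ENNReal) * ENNReal.ofReal p ^ (m + 1) := by
  classical
  have hfin := fun m => hdeg.finite_closedWalk hd x (m + 1)
  let _ := fun m => Fintype.ofFinite (G.ClosedWalk x (m + 1))
  let B (m : ℕ) (c : G.ClosedWalk x (m + 1)) (e : {e : G.E // G.tail e = x}) :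
      Set (G.UEdge → ℝ) :=
    {lbl | G.IsSimpleCycle (m + 1) c.1 x ∧ c.1 0 = e.1 ∧ ∀ j, lbl (G.uedge (c.1 j)) ≤ p}
  have hsub : ∀ e : {e : G.E // G.tail e = x},
      {lbl | lbl (G.uedge e.1) ≤ p ∧ G.IsCut lbl e.1} ⊆ ⋃ m, ⋃ c, B m c e := by
    rintro ⟨e, rfl⟩ lbl ⟨hle, hcut⟩
    obtain ⟨m, c, hc, h0, hmax⟩ := isCut_iff.1 hcut
    exact Set.mem_iUnion₂.2 ⟨m, ⟨c, hc.2.1⟩, hc, h0, fun j => (hmax j).trans hle⟩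
  have hB : ∀ m c e, μ (B m c e) ≤
      if c.1 0 = e.1 then ENNReal.ofReal p ^ (m + 1) else 0 := by
    intro m c e
    split_ifs with h0
    · by_cases hc : G.IsSimpleCycle (m + 1) c.1 x
      · have hinj := (isSimpleCycle_succ_iff.1 hc).2.2.2
        refine (measure_mono fun lbl h => h.2.2).trans
          (hμ.measure_forall_le hinj hp).le |>.trans (by simp)
      · simp [B, hc]
    · simp [B, h0]
  have hsum : ∀ m (c : G.ClosedWalk x (m + 1)),
      (∑ e : {e : G.E // G.tail e = x}, if c.1 0 = e.1 then ENNReal.ofReal p ^ (m + 1) else 0) =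
        ENNReal.ofReal p ^ (m + 1) := by
    intro m c
    have h0 : G.tail (c.1 0) = x := (isWalkFromTo_succ_iff.1 c.2).2
    rw [Finset.sum_eq_single ⟨c.1 0, h0⟩]
    · simp
    · intro e _ hne
      rw [if_neg]
      rintro h
      exact hne (Subtype.ext h.symm)
    · simp
  calc ∑ e : {e : G.E // G.tail e = x}, μ {lbl | lbl (G.uedge e.1) ≤ p ∧ G.IsCut lbl e.1}
      ≤ ∑ e : {e : G.E // G.tail e = x}, ∑' m, ∑ c, μ (B m c e) := by
        refine Finset.sum_le_sum fun e _ => (measure_mono (hsub e)).trans ?_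
        refine (measure_iUnion_le _).trans (ENNReal.tsum_le_tsum fun m => ?_)
        exact measure_iUnion_fintype_le μ _
    _ = ∑' m, ∑ c, ∑ e, μ (B m c e) := by
        rw [← Summable.tsum_finsetSum fun _ _ => ENNReal.summable]
        exact tsum_congr fun m => Finset.sum_comm
    _ ≤ ∑' m, ∑ c : G.ClosedWalk x (m + 1), ENNReal.ofReal p ^ (m + 1) := by
        refine ENNReal.tsum_le_tsum fun m => Finset.sum_le_sum fun c _ => ?_
        rw [← hsum m c]
        exact Finset.sum_le_sum fun e _ => hB m c e
    _ = _ := by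
        refine tsum_congr fun m => ?_
        rw [Finset.sum_const, nsmul_eq_mul, Finset.card_univ, ← Nat.card_eq_fintype_card]
        rfl

/-! ### The expected degree -/

open Classical in
lemma survivingDegree_eq_sum (lbl : G.UEdge → ℝ) (x : G.V)
    [Fintype {e : G.E // G.tail e = x}] :
    (G.survivingDegree lbl x : ℝ) = ∑ e : {e : G.E // G.tail e = x},
      {lbl | G.Survives lbl e.1}.indicator (fun _ => (1 : ℝ)) lbl := by
  unfold survivingDegree
  rw [Nat.card_eq_fintype_card, Fintype.card_subtype, Finset.card_filter]
  push_cast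
  rfl

lemma Degree.measurableSet_survives {d : ℕ} (hdeg : G.Degree d) (hd : 1 ≤ d) (e : G.E) :
    MeasurableSet {lbl | G.Survives lbl e} :=
  (hdeg.measurableSet_isCut hd e).compl

lemma Degree.integrable_survivingDegree {d : ℕ} (hdeg : G.Degree d) (hd : 1 ≤ d) (x : G.V)
    (μ : Measure (G.UEdge → ℝ)) [IsProbabilityMeasure μ] :
    Integrable (fun lbl => (G.survivingDegree lbl x : ℝ)) μ := by
  have := hdeg.finite hd x
  let _ := Fintype.ofFinite {e : G.E // G.tail e = x}
  simp only [survivingDegree_eq_sum]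
  exact integrable_finsetSum _ fun e _ =>
    (integrable_const 1).indicator (hdeg.measurableSet_survives hd e.1)

lemma Degree.integral_survivingDegree {d : ℕ} (hdeg : G.Degree d) (hd : 1 ≤ d) (x : G.V)
    [Fintype {e : G.E // G.tail e = x}] (μ : Measure (G.UEdge → ℝ)) [IsProbabilityMeasure μ] :
    ∫ lbl, (G.survivingDegree lbl x : ℝ) ∂μ =
      ∑ e : {e : G.E // G.tail e = x}, μ.real {lbl | G.Survives lbl e.1} := by
  simp only [survivingDegree_eq_sum]
  rw [integral_finsetSum _ fun e _ =>
    (integrable_const 1).indicator (hdeg.measurableSet_survives hd e.1)]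
  refine Finset.sum_congr rfl fun e _ => ?_
  exact integral_indicator_one (hdeg.measurableSet_survives hd e.1)

/-- If the edges at `x` have distinct labels and not all of them are loops, then the non-loop
with minimal label survives. -/
lemma exists_survives {x : G.V} [Finite {e : G.E // G.tail e = x}] {lbl : G.UEdge → ℝ}
    (hlbl : ∀ e f : {e : G.E // G.tail e = x}, G.uedge e.1 ≠ G.uedge f.1 →
      lbl (G.uedge e.1) ≠ lbl (G.uedge f.1))
    (hloop : ∃ e, G.tail e = x ∧ G.head e ≠ x) :
    ∃ e, G.tail e = x ∧ G.Survives lbl e := by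
  obtain ⟨e₀, he₀, hne₀⟩ := hloop
  obtain ⟨⟨e, he⟩, hne, hmin⟩ :=
    (Set.toFinite {e : {e : G.E // G.tail e = x} | G.head e.1 ≠ x}).exists_minimalFor
      (fun e => lbl (G.uedge e.1)) _ ⟨⟨e₀, he₀⟩, hne₀⟩
  refine ⟨e, he, fun hcut => ?_⟩
  obtain ⟨m, c, hc, rfl, hmax⟩ := isCut_iff.1 hcut
  obtain ⟨hcyc, -, hinj, hu⟩ := isSimpleCycle_succ_iff.1 hc
  have hm : Fin.last m ≠ 0 := fun h => hne (by
    have := hcyc (Fin.last m)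
    rw [Fin.last_add_one, h] at this
    exact this.trans he)
  have hf : G.tail (G.op (c (Fin.last m))) = x := by
    rw [G.tail_op, hcyc, Fin.last_add_one, he]
  have hfne : G.head (G.op (c (Fin.last m))) ≠ x := by
    rw [G.head_op, ← he]
    exact fun h => hm (hinj h)
  have hle : lbl (G.uedge (G.op (c (Fin.last m)))) ≤ lbl (G.uedge (c 0)) := by
    rw [uedge_op]
    exact hmax _
  refine hlbl ⟨_, hf⟩ ⟨_, he⟩ ?_
    (hle.antisymm (hmin (j := ⟨_, hf⟩) hfne hle))
  rw [uedge_op]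
  exact fun h => hm (hu h)

lemma Degree.one_le_integral_survivingDegree {d : ℕ} (hdeg : G.Degree d) (hd : 1 ≤ d)
    {x : G.V} {μ : Measure (G.UEdge → ℝ)} (hμ : G.IsIIDUniform μ)
    (hloop : ∃ e, G.tail e = x ∧ G.head e ≠ x) :
    1 ≤ ∫ lbl, (G.survivingDegree lbl x : ℝ) ∂μ := by
  have := hμ.1
  have := hdeg.finite hd x
  have hae : ∀ᵐ lbl ∂μ, ∀ e f : {e : G.E // G.tail e = x}, G.uedge e.1 ≠ G.uedge f.1 →
      lbl (G.uedge e.1) ≠ lbl (G.uedge f.1) :=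
    ae_all_iff.2 fun e => ae_all_iff.2 fun f => by
      by_cases h : G.uedge e.1 = G.uedge f.1
      · simp [h]
      · simpa [h] using hμ.ae_ne h
  calc (1 : ℝ) = ∫ _, (1 : ℝ) ∂μ := by simp
    _ ≤ _ := by
      refine integral_mono_ae (integrable_const 1) (hdeg.integrable_survivingDegree hd x μ) ?_
      filter_upwards [hae] with lbl hlbl
      obtain ⟨e, he, hs⟩ := exists_survives hlbl hloop
      have : 1 ≤ G.survivingDegree lbl x := Nat.card_pos_iff.2 ⟨⟨⟨⟨e, he⟩, hs⟩⟩, inferInstance⟩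
      exact_mod_cast this

lemma Degree.integral_survivingDegree_le {d : ℕ} (hdeg : G.Degree d) (hd : 1 ≤ d)
    (x : G.V) (μ : Measure (G.UEdge → ℝ)) [IsProbabilityMeasure μ] :
    ∫ lbl, (G.survivingDegree lbl x : ℝ) ∂μ ≤ d := by
  have := hdeg.finite hd x
  calc ∫ lbl, (G.survivingDegree lbl x : ℝ) ∂μ ≤ ∫ _, (d : ℝ) ∂μ := by
        refine integral_mono (hdeg.integrable_survivingDegree hd x μ) (integrable_const _) ?_
        intro lbl
        have : G.survivingDegree lbl x ≤ d := by
          rw [← hdeg x]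
          exact Nat.card_le_card_of_injective _ Subtype.val_injective
        exact Nat.cast_le.2 this
    _ = d := by simp

/-- Keeping only the edges with label at most `1 / (2dλ)`. -/
lemma Degree.half_inv_spectralRadius_sub_one_le {d : ℕ} (hdeg : G.Degree d) (hd : 1 ≤ d)
    {x : G.V} {μ : Measure (G.UEdge → ℝ)} (hμ : G.IsIIDUniform μ)
    (hpos : 0 < G.spectralRadius d x) :
    1 / (2 * G.spectralRadius d x) - 1 ≤ ∫ lbl, (G.survivingDegree lbl x : ℝ) ∂μ := by
  have := hμ.1
  have := hdeg.finite hd x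
  let _ := Fintype.ofFinite {e : G.E // G.tail e = x}
  have hd0 : (0 : ℝ) < d := by positivity
  set L := d * G.spectralRadius d x with hL
  have hL1 : 1 ≤ L := hdeg.one_le_mul_spectralRadius hd x hpos.le
  set p : ℝ := 1 / (2 * L) with hp
  have hp0 : 0 ≤ p := by positivity
  have hp1 : p ≤ 1 := by
    rw [hp, div_le_one (by positivity)]
    linarith
  have hcut : ∑ e : {e : G.E // G.tail e = x},
      μ {lbl | lbl (G.uedge e.1) ≤ p ∧ G.IsCut lbl e.1} ≤ 1 := by
    refine (hdeg.sum_measure_isCut_le hd x hμ hp1).trans ?_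
    have hgeom : ∑' m : ℕ, (2⁻¹ : ENNReal) ^ (m + 1) = 1 := by
      rw [ENNReal.tsum_geometric_add_one, ENNReal.one_sub_inv_two, inv_inv,
        ENNReal.inv_mul_cancel two_ne_zero ENNReal.ofNat_ne_top]
    rw [← hgeom]
    refine ENNReal.tsum_le_tsum fun m => ?_
    have hhalf : (2⁻¹ : ENNReal) = ENNReal.ofReal (L * p) := by
      rw [show L * p = 2⁻¹ by rw [hp]; field_simp, ENNReal.ofReal_inv_of_pos two_pos,
        ENNReal.ofReal_ofNat]
    rw [hhalf, ← ENNReal.ofReal_natCast, ← ENNReal.ofReal_pow hp0,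
      ← ENNReal.ofReal_mul (by positivity), ← ENNReal.ofReal_pow (by positivity), mul_pow]
    exact ENNReal.ofReal_le_ofReal (mul_le_mul_of_nonneg_right
      (hdeg.pathCount_le_spectralRadius_pow hd x m.succ_ne_zero) (by positivity))
  have hcut' : ∑ e : {e : G.E // G.tail e = x},
      μ.real {lbl | lbl (G.uedge e.1) ≤ p ∧ G.IsCut lbl e.1} ≤ 1 := by
    simp only [Measure.real]
    rw [← ENNReal.toReal_sum fun _ _ => measure_ne_top _ _]
    exact ENNReal.toReal_le_of_le_ofReal zero_le_one (by simpa using hcut)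
  have hedge : ∀ e : {e : G.E // G.tail e = x}, p ≤ μ.real {lbl | G.Survives lbl e.1} +
      μ.real {lbl | lbl (G.uedge e.1) ≤ p ∧ G.IsCut lbl e.1} := by
    intro e
    have h1 := hμ.measure_forall_le (a := fun _ : Unit => G.uedge e.1)
      (Function.injective_of_subsingleton _) hp1
    have h2 : μ.real {lbl | ∀ _ : Unit, lbl (G.uedge e.1) ≤ p} = p := by
      rw [Measure.real, h1]
      simp [hp0]
    refine h2.ge.trans <| (measureReal_mono fun lbl h => ?_).trans (measureReal_union_le _ _)
    by_cases hc : G.IsCut lbl e.1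
    · exact Or.inr ⟨h (), hc⟩
    · exact Or.inl hc
  have hsum := Finset.sum_le_sum fun e (_ : e ∈ Finset.univ) => hedge e
  rw [Finset.sum_add_distrib, Finset.sum_const, Finset.card_univ, ← Nat.card_eq_fintype_card,
    hdeg x, nsmul_eq_mul, ← hdeg.integral_survivingDegree hd x μ] at hsum
  have hdp : d * p = 1 / (2 * G.spectralRadius d x) := by
    rw [hp, hL]
    field_simp
  linarith

end Multigraph

/-- Let `G` be a connected vertex-transitive graph of degree `d` and spectral
radius `λ`. Then the expected degree `δ` of the free minimal spanning forest of `G`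
(the expectation, w.r.t. i.i.d. uniform `[0,1]` edge labels, of the number of edges at a
fixed vertex surviving the cycle-cutting procedure) satisfies
`1/(4λ) − 1/4 ≤ δ ≤ d`. -/
theorem fmsf_expected_degree_bounds (G : Multigraph) (d : ℕ) (hd : 1 ≤ d)
    (hdeg : G.Degree d) (htrans : G.VertexTransitive) (hconn : G.Connected)
    (x₀ : G.V) (lam : ℝ) (hlam : lam = G.spectralRadius d x₀)
    (μ : Measure (G.UEdge → ℝ)) (hμ : G.IsIIDUniform μ)
    (δ : ℝ) (hδ : δ = ∫ lbl, (G.survivingDegree lbl x₀ : ℝ) ∂μ) :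
    1 / (4 * lam) - 1 / 4 ≤ δ ∧ δ ≤ d := by
  have := hμ.1
  subst hlam hδ
  refine ⟨?_, hdeg.integral_survivingDegree_le hd x₀ μ⟩
  set lam := G.spectralRadius d x₀
  set δ := ∫ lbl, (G.survivingDegree lbl x₀ : ℝ) ∂μ
  have hδ0 : 0 ≤ δ := integral_nonneg fun _ => by positivity
  rcases le_or_gt lam 0 with h0 | hpos
  · have : 1 / (4 * lam) ≤ 0 := one_div_nonpos.2 (by linarith)
    linarith
  have hquarter : 1 / (4 * lam) = 1 / lam / 4 := by field_simp
  have hhalf : 1 / (2 * lam) = 1 / lam / 2 := by field_simp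
  have hmain : 1 / (2 * lam) - 1 ≤ δ := hdeg.half_inv_spectralRadius_sub_one_le hd hμ hpos
  rw [hquarter]
  rw [hhalf] at hmain
  by_cases hloop : ∃ e, G.tail e = x₀ ∧ G.head e ≠ x₀
  · have h1 : 1 ≤ δ := hdeg.one_le_integral_survivingDegree hd hμ hloop
    rcases le_total (1 / lam) 5 with h | h <;> linarith
  · push Not at hloop
    have h1 : 1 / lam ≤ 1 :=
      (div_le_one hpos).2 (hdeg.one_le_spectralRadius_of_loops hd x₀ hloop)
    linarith
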